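/- If p ≤ d, then the family {τ_ρ : ρ a perfect matching on Fin (2*p)} of multilinear maps (EuclideanSpace ℝ (Fin d))^(2p) → ℝ is linearly independent over ℝ. -/

import Mathlib

open scoped BigOperators InnerProductSpace

/-- A perfect matching on `Fin (2*p)`: a partition of `Fin (2*p)` into parts of cardinality 2. -/
def PerfMatching (p : ℕ) : Type :=
  {ρ : Finpartition (Finset.univ : Finset (Fin (2 * p))) // ∀ s ∈ ρ.parts, s.card = 2}

noncomputable instance (n : ℕ) : Fintype (Finpartition (Finset.univ : Finset (Fin n))) :=
  Fintype.ofInjective Finpartition.parts fun _ _ h => Finpartition.ext h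

noncomputable instance (p : ℕ) : Fintype (PerfMatching p) :=
  Subtype.fintype _

/-- The invariant tensor `τ_ρ` associated to a perfect matching `ρ`:
`τ_ρ (x₁, …, x_{2p}) = ∏_{{i,j} ∈ ρ} ⟪x i, x j⟫`. -/
noncomputable def tauFun {p : ℕ} (d : ℕ) (ρ : PerfMatching p)
    (x : Fin (2 * p) → EuclideanSpace ℝ (Fin d)) : ℝ :=
  ∏ s ∈ ρ.1.parts, if h : s.Nonempty then ⟪x (s.min' h), x (s.max' h)⟫_ℝ else 1

namespace PerfMatching

variable {p : ℕ}

lemma card_parts (ρ : PerfMatching p) : ρ.1.parts.card = p := by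
  have h := ρ.1.sum_card_parts
  rw [Finset.sum_congr rfl ρ.2] at h
  simp at h
  lia

lemma eq_of_parts_subset {ρ σ : PerfMatching p} (h : ρ.1.parts ⊆ σ.1.parts) : ρ = σ :=
  Subtype.ext <| Finpartition.ext <|
    Finset.eq_of_subset_of_card_le h (by rw [card_parts, card_parts])

end PerfMatching

/-- Give each pair of `σ` its own vector of the standard basis: the resulting tuple separates
`σ` from all other perfect matchings. -/
lemma exists_tauFun_ne_zero {d p : ℕ} (hpd : p ≤ d) (σ : PerfMatching p) :
    ∃ x : Fin (2 * p) → EuclideanSpace ℝ (Fin d),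
      tauFun d σ x ≠ 0 ∧ ∀ ρ : PerfMatching p, ρ ≠ σ → tauFun d ρ x = 0 := by
  obtain ⟨c⟩ : Nonempty (σ.1.parts ↪ Fin d) :=
    Function.Embedding.nonempty_of_card_le (by simpa [σ.card_parts] using hpd)
  have hmem (i : Fin (2 * p)) : σ.1.part i ∈ σ.1.parts :=
    σ.1.part_mem.2 (Finset.mem_univ i)
  have hinner (i j : Fin (2 * p)) :
      ⟪EuclideanSpace.single (c ⟨_, hmem i⟩) (1 : ℝ), EuclideanSpace.single (c ⟨_, hmem j⟩) 1⟫_ℝ =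
        if σ.1.part i = σ.1.part j then 1 else 0 := by
    simp [EuclideanSpace.inner_single_left]
  refine ⟨fun i => EuclideanSpace.single (c ⟨_, hmem i⟩) 1, ?_, fun ρ hρ => ?_⟩
  · refine Finset.prod_ne_zero_iff.2 fun s hs => ?_
    split_ifs with h
    · rw [hinner, σ.1.part_eq_of_mem hs (s.min'_mem h), σ.1.part_eq_of_mem hs (s.max'_mem h)]
      simp
    · exact one_ne_zero
  · by_contra hne
    refine hρ (PerfMatching.eq_of_parts_subset fun s hs => ?_)
    have hs2 := ρ.2 s hs
    have h : s.Nonempty := Finset.card_pos.1 (by lia)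
    have hpart : σ.1.part (s.min' h) = σ.1.part (s.max' h) := by
      have := Finset.prod_ne_zero_iff.1 hne s hs
      rw [dif_pos h, hinner] at this
      simpa using this
    have hlt := s.min'_lt_max'_of_card (by lia)
    have hpair : {s.min' h, s.max' h} = s := by
      refine Finset.eq_of_subset_of_card_le ?_ (by rw [hs2, Finset.card_pair hlt.ne])
      simp [Finset.insert_subset_iff, s.min'_mem h, s.max'_mem h]
    have hsub : s ⊆ σ.1.part (s.min' h) := by
      refine hpair.symm.subset.trans (Finset.insert_subset_iff.2 ⟨?_, ?_⟩)
      · exact σ.1.mem_part (Finset.mem_univ _)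
      · exact Finset.singleton_subset_iff.2 (hpart ▸ σ.1.mem_part (Finset.mem_univ _))
    rw [Finset.eq_of_subset_of_card_le hsub (by rw [hs2, σ.2 _ (hmem _)])]
    exact hmem _

/-- If `p ≤ d`, the family `{τ_ρ : ρ a perfect matching on Fin (2*p)}` is linearly
independent over `ℝ`. -/
theorem tau_linearIndependent (d p : ℕ) (hpd : p ≤ d) :
    LinearIndependent ℝ (fun ρ : PerfMatching p =>
      (tauFun d ρ : (Fin (2 * p) → EuclideanSpace ℝ (Fin d)) → ℝ)) := by
  refine Fintype.linearIndependent_iff.2 fun g hg σ => ?_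
  obtain ⟨x, hσ, hx⟩ := exists_tauFun_ne_zero hpd σ
  have h := congrFun hg x
  simp only [Finset.sum_apply, Pi.smul_apply, Pi.zero_apply, smul_eq_mul] at h
  rw [Fintype.sum_eq_single σ fun ρ hρ => by rw [hx ρ hρ, mul_zero]] at h
  exact (mul_eq_zero.1 h).resolve_right hσ
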